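/- Let R be a (unital, possibly noncommutative) ring, let M and T be bounded chain complexes of left R-modules such that every term of T is a finitely generated projective R-module, and let f : M → T and g : T → M be chain maps such that the composite g ∘ f is chain homotopic to the identity of M. Then M is homotopy equivalent, as a chain complex, to a bounded chain complex of finitely generated projective R-modules. -/

import Mathlib

open CategoryTheory

/-- A ℤ-indexed chain complex is bounded if all but finitely many terms are zero. -/
def IsBoundedComplex {R : Type} [Ring R] (M : ChainComplex (ModuleCat.{0} R) ℤ) : Prop :=
  {n : ℤ | ¬ Subsingleton (M.X n)}.Finite

/-- Every term of the complex is a finitely generated projective `R`-module. -/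
def IsFinProjComplex {R : Type} [Ring R] (T : ChainComplex (ModuleCat.{0} R) ℤ) : Prop :=
  ∀ n : ℤ, Module.Finite R (T.X n) ∧ Module.Projective R (T.X n)

open Category Limits Pretriangulated

section Restriction

variable {ι ι' : Type*} {c : ComplexShape ι} {c' : ComplexShape ι'} {V : Type*} [Category V]
  [Preadditive V] (e : c.Embedding c') [e.IsTruncGE] [e.IsTruncLE]

/-- The restriction of a homotopy along an embedding of complex shapes whose image is stable
under both `next` and `prev`. -/
def Homotopy.restriction {K L : HomologicalComplex V c'} {f g : K ⟶ L} (h : Homotopy f g) :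
    Homotopy (HomologicalComplex.restrictionMap f e) (HomologicalComplex.restrictionMap g e) where
  hom i j := h.hom (e.f i) (e.f j)
  zero i j hij := h.zero _ _ (by rwa [e.rel_iff])
  comm i := by
    let H (i j : ι) : (K.restriction e).X i ⟶ (L.restriction e).X j := h.hom (e.f i) (e.f j)
    have hn : dNext (e.f i) h.hom = dNext i H := by
      by_cases hi : c.Rel i (c.next i)
      · exact (dNext_eq _ (e.rel hi)).trans (dNext_eq H hi).symm
      · refine (dNext_eq_zero _ _ fun hi' ↦ ?_).trans (dNext_eq_zero H _ hi).symm
        obtain ⟨k, hk⟩ := e.mem_next hi'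
        rw [← hk, e.rel_iff] at hi'
        exact hi (by rwa [c.next_eq' hi'])
    have hp : prevD (e.f i) h.hom = prevD i H := by
      by_cases hi : c.Rel (c.prev i) i
      · exact (prevD_eq _ (e.rel hi)).trans (prevD_eq H hi).symm
      · refine (prevD_eq_zero _ _ fun hi' ↦ ?_).trans (prevD_eq_zero H _ hi).symm
        obtain ⟨k, hk⟩ := e.mem_prev hi'
        rw [← hk, e.rel_iff] at hi'
        exact hi (by rwa [c.prev_eq' hi'])
    exact (h.comm (e.f i)).trans (congrArg₂ (fun x y ↦ x + y + g.f (e.f i)) hn hp)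

/-- The restriction of a homotopy equivalence along an embedding of complex shapes whose image
is stable under both `next` and `prev`. -/
def HomotopyEquiv.restriction {K L : HomologicalComplex V c'} (h : HomotopyEquiv K L) :
    HomotopyEquiv (K.restriction e) (L.restriction e) where
  hom := HomologicalComplex.restrictionMap h.hom e
  inv := HomologicalComplex.restrictionMap h.inv e
  homotopyHomInvId := h.homotopyHomInvId.restriction e
  homotopyInvHomId := h.homotopyInvHomId.restriction e

end Restriction

namespace ComplexShape

instance : embeddingUpIntDownInt.IsTruncGE where
  mem_next {_ k} _ := ⟨-k, neg_neg k⟩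

instance : embeddingUpIntDownInt.IsTruncLE where
  mem_prev {k _} _ := ⟨-k, neg_neg k⟩

instance : embeddingDownIntUpInt.IsTruncGE where
  mem_next {_ k} _ := ⟨-k, neg_neg k⟩

instance : embeddingDownIntUpInt.IsTruncLE where
  mem_prev {k _} _ := ⟨-k, neg_neg k⟩

end ComplexShape

namespace CochainComplex

variable {V : Type*} [Category V] [Abelian V] (P : ObjectProperty V)

/-- All terms of the complex satisfy `P`, and they vanish outside of the degrees `a, …, b`. -/
structure IsBoundedOf (T : CochainComplex V ℤ) (a b : ℤ) : Prop where
  prop (n : ℤ) : P (T.X n)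
  isZero (n : ℤ) (hn : n < a ∨ b < n) : IsZero (T.X n)

variable {P}

lemma IsBoundedOf.shift {T : CochainComplex V ℤ} {a b : ℤ} (hT : IsBoundedOf P T a b) (k : ℤ) :
    IsBoundedOf P (T⟦k⟧) (a - k) (b - k) where
  prop n := hT.prop (n + k)
  isZero n hn := hT.isZero (n + k) (by lia)

section

variable [P.IsStableUnderRetracts]

lemma IsBoundedOf.of_retract {S T : CochainComplex V ℤ} {a b : ℤ} (hT : IsBoundedOf P T a b)
    (r : Retract S T) : IsBoundedOf P S a b where
  prop n := P.prop_of_retract (r.map (HomologicalComplex.eval V _ n)) (hT.prop n)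
  isZero n hn :=
    let r' : Retract (S.X n) (T.X n) := r.map (HomologicalComplex.eval V _ n)
    IsZero.of_mono r'.i (hT.isZero n hn)

lemma IsBoundedOf.biprod (hP : ∀ X Y, P X → P Y → P (X ⊞ Y)) {S T : CochainComplex V ℤ}
    {a b : ℤ} (hS : IsBoundedOf P S a b) (hT : IsBoundedOf P T a b) :
    IsBoundedOf P (S ⊞ T) a b where
  prop n := P.prop_of_iso ((HomologicalComplex.eval V _ n).mapBiprod S T).symm
    (hP _ _ (hS.prop n) (hT.prop n))
  isZero n hn := IsZero.of_iso ((biprod_isZero_iff _ _).2 ⟨hS.isZero n hn, hT.isZero n hn⟩)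
    ((HomologicalComplex.eval V _ n).mapBiprod S T)

lemma IsBoundedOf.mappingCone (hP : ∀ X Y, P X → P Y → P (X ⊞ Y)) {S T : CochainComplex V ℤ}
    {a b a' b' : ℤ} (hS : IsBoundedOf P S a b) (hT : IsBoundedOf P T a' b') (φ : S ⟶ T) :
    IsBoundedOf P (mappingCone φ) (min (a - 1) a') (max b b') where
  prop n := P.prop_of_iso (HomologicalComplex.homotopyCofiber.XIsoBiprod φ n (n + 1) rfl).symm
    (hP _ _ (hS.prop _) (hT.prop n))
  isZero n hn := (mappingCone.isZero_X_iff φ n).2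
    ⟨hS.isZero _ (by lia), hT.isZero n (by lia)⟩

/-- A bounded complex is a degreewise split extension of a complex with one degree less by a complex
concentrated in the top degree. -/
lemma IsBoundedOf.exists_degreewiseSplit {T : CochainComplex V ℤ} {a b : ℤ}
    (hT : IsBoundedOf P T a b) :
    ∃ (S : ShortComplex (CochainComplex V ℤ))
      (_ : ∀ n, (S.map (HomologicalComplex.eval V _ n)).Splitting),
      S.X₂ = T ∧ IsBoundedOf P S.X₁ b b ∧ IsBoundedOf P S.X₃ a (b - 1) := by
  let i : (HomologicalComplex.single V (.up ℤ) b).obj (T.X b) ⟶ T :=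
    HomologicalComplex.mkHomFromSingle (𝟙 _) (fun k hk ↦
      (hT.isZero k (by simp at hk; lia)).eq_of_tgt _ _)
  have hi : IsIso (i.f b) := by
    simp only [i, HomologicalComplex.mkHomFromSingle_f]
    infer_instance
  have hA (n : ℤ) (hn : n ≠ b) := HomologicalComplex.isZero_single_obj_X (.up ℤ) b (T.X b) n hn
  have : Mono i := by
    have (n : ℤ) : Mono (i.f n) := by
      obtain rfl | hn := eq_or_ne n b
      · infer_instance
      · exact ⟨fun _ _ _ ↦ (hA n hn).eq_of_tgt _ _⟩
    exact HomologicalComplex.mono_of_mono_f i this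
  let S := ShortComplex.mk i (cokernel.π i) (by simp)
  have hS : S.ShortExact := { exact := S.exact_of_g_is_cokernel (cokernelIsCokernel i) }
  have hSn (n : ℤ) := hS.map_of_exact (HomologicalComplex.eval V (.up ℤ) n)
  have hb : IsZero (S.X₃.X b) := (hSn b).isIso_f_iff.1 hi
  have σ (n : ℤ) : Nonempty (S.map (HomologicalComplex.eval V _ n)).Splitting := by
    obtain rfl | hn := eq_or_ne n b
    · exact ⟨.ofIsIsoOfIsZero _ hi hb⟩
    · exact ⟨.ofIsZeroOfIsIso _ (hA n hn) ((hSn n).isIso_g_iff.2 (hA n hn))⟩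
  replace σ (n : ℤ) := (σ n).some
  have h₁ (n : ℤ) : Retract (S.X₁.X n) (T.X n) := ⟨_, _, (σ n).f_r⟩
  have h₃ (n : ℤ) : Retract (S.X₃.X n) (T.X n) := ⟨_, _, (σ n).s_g⟩
  refine ⟨S, σ, rfl, ⟨fun n ↦ P.prop_of_retract (h₁ n) (hT.prop n), fun n hn ↦ hA n (by lia)⟩,
    ⟨fun n ↦ P.prop_of_retract (h₃ n) (hT.prop n), fun n hn ↦ ?_⟩⟩
  obtain rfl | hnb := eq_or_ne n b
  · exact hb
  · exact IsZero.of_mono (h₃ n).i (hT.isZero n (by lia))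

end

lemma IsBoundedOf.eq_of_homotopy {S T : CochainComplex V ℤ} {b : ℤ} (hS : IsBoundedOf P S b b)
    (hT : IsBoundedOf P T b b) {f g : S ⟶ T} (h : Homotopy f g) : f = g := by
  ext n
  obtain rfl | hn := eq_or_ne n b
  · rw [h.comm n, dNext_eq _ (show (ComplexShape.up ℤ).Rel n (n + 1) from rfl),
      prevD_eq _ (show (ComplexShape.up ℤ).Rel (n - 1) n by simp),
      (hS.isZero (n + 1) (by lia)).eq_of_tgt (S.d n (n + 1)) 0,
      (hT.isZero (n - 1) (by lia)).eq_of_tgt (h.hom n (n - 1)) 0]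
    simp
  · exact (hS.isZero n (by lia)).eq_of_src _ _

end CochainComplex

namespace HomotopyCategory

open CochainComplex

variable {V : Type*} [Category V] [Abelian V] (P : ObjectProperty V)

/-- The objects of the homotopy category which are represented by a bounded complex whose terms
satisfy `P`. -/
def boundedOf : ObjectProperty (HomotopyCategory V (.up ℤ)) := fun X ↦
  ∃ (Y : CochainComplex V ℤ) (a b : ℤ), IsBoundedOf P Y a b ∧ Nonempty (X ≅ (quotient V _).obj Y)

variable {P} [P.IsStableUnderRetracts]

lemma boundedOf_of_distTriang (hP : ∀ X Y, P X → P Y → P (X ⊞ Y))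
    (T : Triangle (HomotopyCategory V (.up ℤ))) (hT : T ∈ distTriang _)
    (h₁ : boundedOf P T.obj₁) (h₃ : boundedOf P T.obj₃) : boundedOf P T.obj₂ := by
  obtain ⟨Y₁, a₁, b₁, hY₁, ⟨e₁⟩⟩ := h₁
  obtain ⟨Y₃, a₃, b₃, hY₃, ⟨e₃⟩⟩ := h₃
  let e₁' : T.obj₁⟦(1 : ℤ)⟧ ≅ (quotient V (.up ℤ)).obj (Y₁⟦(1 : ℤ)⟧) :=
    (CategoryTheory.shiftFunctor _ (1 : ℤ)).mapIso e₁ ≪≫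
      (((quotient V (.up ℤ)).commShiftIso (1 : ℤ)).app Y₁).symm
  obtain ⟨φ, hφ⟩ := (quotient V (.up ℤ)).map_surjective (e₃.inv ≫ T.mor₃ ≫ e₁'.hom)
  let e : T.obj₂⟦(1 : ℤ)⟧ ≅ (quotient V (.up ℤ)).obj (mappingCone φ) :=
    Triangle.π₃.mapIso (isoTriangleOfIso₁₂ _ _ (rot_of_distTriang _ (rot_of_distTriang _ hT))
      (mappingCone_triangleh_distinguished φ) e₃ e₁' (by
        change T.mor₃ ≫ e₁'.hom = e₃.hom ≫ (quotient V (.up ℤ)).map φ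
        rw [hφ, e₃.hom_inv_id_assoc]))
  exact ⟨_, _, _, (hY₃.mappingCone hP (hY₁.shift 1) φ).shift (-1),
    ⟨(shiftShiftNeg T.obj₂ (1 : ℤ)).symm ≪≫ (CategoryTheory.shiftFunctor _ (-1 : ℤ)).mapIso e ≪≫
      (((quotient V (.up ℤ)).commShiftIso (-1 : ℤ)).app _).symm⟩⟩

lemma boundedOf_of_retract_of_concentrated {T : CochainComplex V ℤ} {b : ℤ}
    (hT : IsBoundedOf P T b b) {X : HomotopyCategory V (.up ℤ)}
    (r : Retract X ((quotient V _).obj T)) : boundedOf P X := by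
  obtain ⟨p, hp⟩ := (quotient V (.up ℤ)).map_surjective (r.r ≫ r.i)
  have hpp : p ≫ p = p := hT.eq_of_homotopy hT (homotopyOfEq _ _ (by simp [hp]))
  obtain ⟨Y, i, s, his, hsi⟩ := IsIdempotentComplete.idempotents_split T p hpp
  refine ⟨Y, b, b, hT.of_retract ⟨i, s, his⟩, ⟨⟨r.i ≫ (quotient V _).map s,
    (quotient V _).map i ≫ r.r, ?_, ?_⟩⟩⟩
  · rw [assoc, ← Functor.map_comp_assoc, hsi, hp]
    simp
  · rw [assoc, ← reassoc_of% hp, ← Functor.map_comp, ← Functor.map_comp, ← hsi, assoc, his,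
      comp_id, his]
    exact (quotient V _).map_id Y

lemma boundedOf_of_retract (hP : ∀ X Y, P X → P Y → P (X ⊞ Y)) (k : ℕ) (b : ℤ)
    {T : CochainComplex V ℤ} (hT : IsBoundedOf P T (b - k) b) {X : HomotopyCategory V (.up ℤ)}
    (r : Retract X ((quotient V _).obj T)) : boundedOf P X := by
  induction k generalizing b T X with
  | zero => exact boundedOf_of_retract_of_concentrated (by simpa using hT) r
  | succ k ih =>
    obtain ⟨S, σ, rfl, h₁, h₃⟩ := hT.exists_degreewiseSplit
    have hS : trianglehOfDegreewiseSplit S σ ∈ distTriang _ :=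
      (distinguished_iff_iso_trianglehOfDegreewiseSplit _).2 ⟨S, σ, ⟨Iso.refl _⟩⟩
    obtain ⟨C, j, δ, hC⟩ := distinguished_cocone_triangle ((quotient V _).map S.f ≫ r.r)
    have hzero : (quotient V (.up ℤ)).map S.f ≫ r.r ≫ r.i ≫ (quotient V (.up ℤ)).map S.g = 0 := by
      obtain ⟨φ, hφ⟩ := (quotient V (.up ℤ)).map_surjective
        ((quotient V (.up ℤ)).map S.f ≫ r.r ≫ r.i ≫ (quotient V (.up ℤ)).map S.g)
      have : φ = 0 := by
        ext n
        by_cases hn : n = b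
        · exact (h₃.isZero n (by lia)).eq_of_tgt _ _
        · exact (h₁.isZero n (by lia)).eq_of_src _ _
      rw [← hφ, this, Functor.map_zero]
    obtain ⟨u, hu⟩ : ∃ u : C ⟶ (quotient V (.up ℤ)).obj S.X₃,
        r.i ≫ (quotient V (.up ℤ)).map S.g = j ≫ u :=
      Triangle.yoneda_exact₂ _ hC _ ((assoc _ _ _).trans hzero)
    obtain ⟨v : (quotient V (.up ℤ)).obj S.X₃ ⟶ C,
        hv : (quotient V (.up ℤ)).map S.g ≫ v = r.r ≫ j, -⟩ :=
      complete_distinguished_triangle_morphism _ _ hS hC (𝟙 _) r.r (id_comp _).symm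
    obtain ⟨w, hw⟩ : ∃ w : ((quotient V (.up ℤ)).obj S.X₁)⟦(1 : ℤ)⟧ ⟶ C,
        𝟙 C - (u ≫ v : C ⟶ C) = δ ≫ w :=
      Triangle.yoneda_exact₃ _ hC _ (by
        change j ≫ (𝟙 C - (u ≫ v : C ⟶ C)) = 0
        rw [Preadditive.comp_sub, ← reassoc_of% hu, hv, r.retract_assoc, comp_id, sub_self])
    let e := ((quotient V (.up ℤ)).commShiftIso (1 : ℤ)).app S.X₁
    have rC : Retract C ((quotient V (.up ℤ)).obj (S.X₃ ⊞ S.X₁⟦(1 : ℤ)⟧)) :=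
      { i := u ≫ (quotient V _).map biprod.inl + δ ≫ e.inv ≫ (quotient V _).map biprod.inr
        r := (quotient V _).map biprod.fst ≫ v + (quotient V _).map biprod.snd ≫ e.hom ≫ w
        retract := by
          simp [← Functor.map_comp_assoc, ← hw] }
    have hT' : IsBoundedOf P (S.X₃ ⊞ S.X₁⟦(1 : ℤ)⟧) (b - 1 - k) (b - 1) := by
      refine .biprod hP ⟨h₃.prop, fun n hn ↦ h₃.isZero n (by push_cast; lia)⟩
        ⟨(h₁.shift 1).prop, fun n hn ↦ (h₁.shift 1).isZero n (by lia)⟩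
    exact boundedOf_of_distTriang hP _ hC ⟨_, _, _, h₁, ⟨Iso.refl _⟩⟩ (ih _ hT' rC)

end HomotopyCategory

/-- The property of being a finitely generated projective module. -/
def ModuleCat.finiteProjective (R : Type) [Ring R] : ObjectProperty (ModuleCat.{0} R) :=
  fun X ↦ Module.Finite R X ∧ Module.Projective R X

instance (R : Type) [Ring R] : (ModuleCat.finiteProjective R).IsStableUnderRetracts where
  of_retract r := fun ⟨_, _⟩ ↦
    have h : r.r.hom ∘ₗ r.i.hom = .id := by
      rw [← ModuleCat.hom_comp, r.retract, ModuleCat.hom_id]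
    ⟨.of_surjective r.r.hom fun x ↦ ⟨r.i.hom x, LinearMap.congr_fun h x⟩, .of_split _ _ h⟩

lemma ModuleCat.finiteProjective_biprod (R : Type) [Ring R] (X Y : ModuleCat.{0} R)
    (hX : finiteProjective R X) (hY : finiteProjective R Y) : finiteProjective R (X ⊞ Y) := by
  obtain ⟨_, _⟩ := hX
  obtain ⟨_, _⟩ := hY
  exact (finiteProjective R).prop_of_iso (biprodIsoProd X Y).symm
    ⟨inferInstanceAs (Module.Finite R (X × Y)), inferInstanceAs (Module.Projective R (X × Y))⟩

/-- If `M` is a bounded chain complex of left `R`-modules that is dominated (up to chain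
homotopy) by a bounded complex `T` of finitely generated projective modules, i.e. there are
chain maps `f : M ⟶ T` and `g : T ⟶ M` with `g ∘ f` homotopic to the identity, then `M` is
homotopy equivalent to a bounded complex of finitely generated projective `R`-modules. -/
theorem stmt0 (R : Type) [Ring R] (M T : ChainComplex (ModuleCat.{0} R) ℤ)
    (hM : IsBoundedComplex M) (hT : IsBoundedComplex T) (hTproj : IsFinProjComplex T)
    (f : M ⟶ T) (g : T ⟶ M) (h : Homotopy (f ≫ g) (𝟙 M)) :
    ∃ P : ChainComplex (ModuleCat.{0} R) ℤ, IsBoundedComplex P ∧ IsFinProjComplex P ∧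
      Nonempty (HomotopyEquiv M P) := by
  obtain ⟨a, ha⟩ := hT.bddAbove
  obtain ⟨b, hb⟩ := hT.bddBelow
  have hT' : CochainComplex.IsBoundedOf (ModuleCat.finiteProjective R)
      (T.restriction ComplexShape.embeddingUpIntDownInt) (-b - (a - b).toNat) (-b) := by
    refine ⟨fun n ↦ hTproj (-n), fun n hn ↦ ?_⟩
    have : Subsingleton (T.X (-n)) := by
      by_contra hn'
      have h₁ := ha hn'
      have h₂ := hb hn'
      lia
    exact ModuleCat.isZero_of_subsingleton (T.X (-n))
  obtain ⟨Y, a', b', hY, ⟨e⟩⟩ := HomotopyCategory.boundedOf_of_retract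
    (ModuleCat.finiteProjective_biprod R) _ _ hT'
    (X := (HomotopyCategory.quotient _ _).obj (M.restriction ComplexShape.embeddingUpIntDownInt))
    { i := (HomotopyCategory.quotient _ _).map (HomologicalComplex.restrictionMap f _)
      r := (HomotopyCategory.quotient _ _).map (HomologicalComplex.restrictionMap g _)
      retract := by
        rw [← Functor.map_comp]
        exact (HomotopyCategory.eq_of_homotopy _ _
          (h.restriction ComplexShape.embeddingUpIntDownInt)).trans
          ((HomotopyCategory.quotient _ _).map_id _) }
  refine ⟨Y.restriction ComplexShape.embeddingDownIntUpInt,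
    (Set.finite_Icc (-b') (-a')).subset fun n hn ↦ ?_, fun n ↦ hY.prop (-n),
    ⟨(HomotopyEquiv.ofIso ((ChainComplex.cochainComplexEquivalence _).unitIso.app M)).trans
      ((HomotopyCategory.homotopyEquivOfIso e).restriction ComplexShape.embeddingDownIntUpInt)⟩⟩
  by_contra hn'
  rw [Set.mem_Icc] at hn'
  exact hn (ModuleCat.subsingleton_of_isZero (hY.isZero (-n) (by lia)))
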